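/- arXiv:2504.10722 — 4 statements merged into one kernel-verified Lean document; each statement's English description precedes it below -/
import Mathlib

section
/- Let D be a unique factorization domain that is not a field, let K be a field containing D (i.e., K is a field equipped with an injective ring homomorphism from D, so K contains the fraction field of D). Then the subring R = D + xK[x] of K[x], consisting of all polynomials over K whose constant coefficient lies in (the image of) D, is a GL-domain. -/
/-- A polynomial over `R` is primitive if every element of `R` dividing all of its
coefficients is a unit. -/
def IsPrimitivePoly {R : Type*} [CommRing R] (f : Polynomial R) : Prop :=
  ∀ d : R, (∀ n : ℕ, d ∣ f.coeff n) → IsUnit d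

/-- `R` is a GL-domain if the product of any two primitive polynomials over `R` is
again primitive. -/
def IsGLDomain (R : Type*) [CommRing R] : Prop :=
  ∀ f g : Polynomial R, IsPrimitivePoly f → IsPrimitivePoly g → IsPrimitivePoly (f * g)

/-- The subring `D + x K[x]` of `K[x]`: polynomials over `K` whose constant
coefficient lies in the image of `D` under `ι`. -/
noncomputable def DplusXKX {D K : Type*} [CommRing D] [Field K] (ι : D →+* K) :
    Subring (Polynomial K) :=
  Subring.comap (Polynomial.constantCoeff (R := K)) ι.range

open Polynomial in
theorem isGLDomain_of_exists_prime_dvd {R : Type*} [CommRing R]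
    (h : ∀ a : R, ¬ IsUnit a → ∃ p, Prime p ∧ p ∣ a) : IsGLDomain R := by
  intro f g hf hg d hd
  by_contra hu
  obtain ⟨p, hp, hpd⟩ := h d hu
  have hfg : C p ∣ f * g := (C_dvd_iff_dvd_coeff _ _).2 fun n => hpd.trans (hd n)
  rcases (prime_C_iff.2 hp).dvd_or_dvd hfg with h | h
  · exact hp.not_isUnit (hf p ((C_dvd_iff_dvd_coeff _ _).1 h))
  · exact hp.not_isUnit (hg p ((C_dvd_iff_dvd_coeff _ _).1 h))

theorem exists_prime_dvd_of_not_isField {D : Type*} [CommRing D] [IsDomain D]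
    [UniqueFactorizationMonoid D] (hD : ¬ IsField D) {a : D} (ha : ¬ IsUnit a) :
    ∃ p, Prime p ∧ p ∣ a := by
  obtain ⟨b, hb0, hb, hba⟩ : ∃ b : D, b ≠ 0 ∧ ¬ IsUnit b ∧ b ∣ a := by
    by_cases h0 : a = 0
    · obtain ⟨b, hb0, hb⟩ := Ring.exists_not_isUnit_of_not_isField hD
      exact ⟨b, hb0, hb, h0 ▸ dvd_zero b⟩
    · exact ⟨a, h0, ha, dvd_rfl⟩
  obtain ⟨p, hp, hpb⟩ := WfDvdMonoid.exists_irreducible_factor hb hb0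
  exact ⟨p, hp.prime, hpb.trans hba⟩

namespace DplusXKX

open Polynomial

variable {D K : Type*} [CommRing D] [Field K] {ι : D →+* K}

theorem mem_iff {a : K[X]} : a ∈ DplusXKX ι ↔ ∃ d, ι d = a.coeff 0 := by
  simp [DplusXKX, Subring.mem_comap, constantCoeff_apply]

variable (ι) in
/-- The constant polynomials with value in `D`. -/
noncomputable def const (d : D) : DplusXKX ι :=
  ⟨C (ι d), mem_iff.2 ⟨d, by simp⟩⟩

theorem const_dvd_iff (hι : Function.Injective ι) {d e : D} (hd : d ≠ 0) {a : DplusXKX ι}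
    (ha : ι e = (a : K[X]).coeff 0) : const ι d ∣ a ↔ d ∣ e := by
  constructor
  · rintro ⟨b, rfl⟩
    obtain ⟨c, hc⟩ := mem_iff.1 b.2
    refine ⟨c, hι ?_⟩
    simp [ha, const, hc]
  · rintro ⟨c, rfl⟩
    have hd' : ι d ≠ 0 := (map_ne_zero_iff ι hι).2 hd
    refine ⟨⟨C (ι d)⁻¹ * a, mem_iff.2 ⟨c, ?_⟩⟩, Subtype.ext ?_⟩
    · rw [coeff_C_mul, ← ha, map_mul, inv_mul_cancel_left₀ hd']
    · simp [const, ← mul_assoc, ← C_mul, hd']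

theorem prime_const (hι : Function.Injective ι) {p : D} (hp : Prime p) :
    Prime (const ι p) := by
  refine ⟨fun h => hp.ne_zero (hι ?_), fun h => hp.not_isUnit ?_, fun a b hab => ?_⟩
  · simpa [const] using congrArg (fun a : DplusXKX ι => (a : K[X]).coeff 0) h
  · rw [isUnit_iff_dvd_one] at h ⊢
    exact (const_dvd_iff hι hp.ne_zero (by simp)).1 h
  · obtain ⟨d, hd⟩ := mem_iff.1 a.2
    obtain ⟨e, he⟩ := mem_iff.1 b.2
    rw [const_dvd_iff hι hp.ne_zero hd, const_dvd_iff hι hp.ne_zero he]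
    refine hp.dvd_or_dvd ((const_dvd_iff hι hp.ne_zero ?_).1 hab)
    simp [hd, he, mul_coeff_zero]

theorem dvd_iff_of_coeff_zero_eq_one {p a : DplusXKX ι} (hp : (p : K[X]).coeff 0 = 1) :
    p ∣ a ↔ (p : K[X]) ∣ a := by
  refine ⟨map_dvd (DplusXKX ι).subtype, ?_⟩
  rintro ⟨q, hq⟩
  obtain ⟨d, hd⟩ := mem_iff.1 a.2
  refine ⟨⟨q, mem_iff.2 ⟨d, ?_⟩⟩, Subtype.ext hq⟩
  rw [hd, hq, mul_coeff_zero, hp, one_mul]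

theorem prime_of_coeff_zero_eq_one {p : DplusXKX ι} (hp : (p : K[X]).coeff 0 = 1)
    (hpp : Prime (p : K[X])) : Prime p := by
  refine ⟨fun h => hpp.ne_zero (by simp [h]), fun h => hpp.not_isUnit ?_, fun a b hab => ?_⟩
  · exact h.map (DplusXKX ι).subtype
  · simp only [dvd_iff_of_coeff_zero_eq_one hp] at hab ⊢
    exact hpp.dvd_or_dvd hab

theorem isUnit_of_isUnit_coeff_zero {a : DplusXKX ι} {d : D} (hd : IsUnit d)
    (ha : ι d = (a : K[X]).coeff 0) (hu : IsUnit (a : K[X])) : IsUnit a := by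
  obtain ⟨e, hde⟩ := hd.exists_right_inv
  refine IsUnit.of_mul_eq_one (const ι e) (Subtype.ext ?_)
  have h : (a : K[X]) = C (ι d) := by
    rw [ha]; exact eq_C_of_degree_eq_zero (degree_eq_zero_of_isUnit hu)
  simp [const, h, ← map_mul, hde]

theorem exists_prime_dvd [IsDomain D] [UniqueFactorizationMonoid D] (hD : ¬ IsField D)
    (hι : Function.Injective ι) {a : DplusXKX ι} (ha : ¬ IsUnit a) :
    ∃ p, Prime p ∧ p ∣ a := by
  obtain ⟨d, hd⟩ := mem_iff.1 a.2
  by_cases hu : IsUnit d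
  · have h0 : (a : K[X]).coeff 0 ≠ 0 := hd ▸ (hu.map ι).ne_zero
    obtain ⟨q, hq, b, hb⟩ := WfDvdMonoid.exists_irreducible_factor
      (fun h => ha (isUnit_of_isUnit_coeff_zero hu hd h)) (fun h => h0 (by simp [h]))
    have hq0 : q.coeff 0 ≠ 0 := fun h => h0 (by rw [hb, mul_coeff_zero, h, zero_mul])
    have hc : IsUnit (C (q.coeff 0)⁻¹) := isUnit_C.2 (inv_ne_zero hq0).isUnit
    have h1 : (C (q.coeff 0)⁻¹ * q).coeff 0 = 1 := by simp [hq0]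
    let p : DplusXKX ι := ⟨C (q.coeff 0)⁻¹ * q, mem_iff.2 ⟨1, by rw [h1, map_one]⟩⟩
    have hassoc : Associated q (p : K[X]) := (associated_unit_mul_left q _ hc).symm
    exact ⟨p, prime_of_coeff_zero_eq_one h1 (hassoc.prime hq.prime),
      (dvd_iff_of_coeff_zero_eq_one h1).2 (hassoc.dvd_iff_dvd_left.1 ⟨b, hb⟩)⟩
  · obtain ⟨p, hp, hpd⟩ := exists_prime_dvd_of_not_isField hD hu
    exact ⟨const ι p, prime_const hι hp, (const_dvd_iff hι hp.ne_zero hd).2 hpd⟩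

end DplusXKX

theorem stmt5 {D K : Type*} [CommRing D] [IsDomain D] [UniqueFactorizationMonoid D]
    (hD : ¬ IsField D) [Field K] (ι : D →+* K) (hι : Function.Injective ι) :
    IsGLDomain ↥(DplusXKX ι) :=
  isGLDomain_of_exists_prime_dvd fun _ ha => DplusXKX.exists_prime_dvd hD hι ha
end

section
/- Let D be an integral domain that is not a field, with fraction field F, and let K be a field containing D (via an injective ring homomorphism ι : D → K) such that there exists α ∈ K not lying in the fraction field of D inside K (i.e., there is no pair a, b ∈ D with b ≠ 0 and α·ι(b) = ι(a)). Then in the subring R = D + xK[x] of K[x], consisting of all polynomials over K whose constant coefficient lies in ι(D), the element x is not primal. -/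
/-- A nonzero element `p` is primal if whenever `p ∣ r * s` we can write `p = p₁ * p₂`
with `p₁ ∣ r` and `p₂ ∣ s`. -/
def IsPrimalElem {R : Type*} [CommRing R] (p : R) : Prop :=
  ∀ r s : R, p ∣ r * s → ∃ p₁ p₂ : R, p = p₁ * p₂ ∧ p₁ ∣ r ∧ p₂ ∣ s

theorem X_mem_DplusXKX {D K : Type*} [CommRing D] [Field K] (ι : D →+* K) :
    Polynomial.X ∈ DplusXKX ι := by
  rw [DplusXKX, Subring.mem_comap]
  simp only [Polynomial.constantCoeff_apply, Polynomial.coeff_X_zero]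
  exact zero_mem _

theorem C_mul_X_mem_DplusXKX {D K : Type*} [CommRing D] [Field K] (ι : D →+* K) (c : K) :
    Polynomial.C c * Polynomial.X ∈ DplusXKX ι := by
  rw [DplusXKX, Subring.mem_comap]
  simp

theorem exists_coeff_zero_of_mem_DplusXKX {D K : Type*} [CommRing D] [Field K] {ι : D →+* K}
    {p : Polynomial K} (hp : p ∈ DplusXKX ι) : ∃ d : D, ι d = p.coeff 0 := by
  simpa [DplusXKX] using hp

theorem stmt6 {D K : Type*} [CommRing D] [IsDomain D] (hD : ¬ IsField D)
    [Field K] (ι : D →+* K) (hι : Function.Injective ι)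
    (α : K) (hα : ¬ ∃ a b : D, b ≠ 0 ∧ α * ι b = ι a) :
    ¬ IsPrimalElem (⟨Polynomial.X, X_mem_DplusXKX ι⟩ : ↥(DplusXKX ι)) := by
  intro h
  have hα0 : α ≠ 0 := by
    rintro rfl
    exact hα ⟨0, 1, one_ne_zero, by simp⟩
  obtain ⟨⟨p, hp⟩, ⟨q, hq⟩, hpq, ⟨⟨u, hu⟩, hpu⟩, ⟨⟨v, hv⟩, hqv⟩⟩ :=
    h ⟨Polynomial.C α * Polynomial.X, C_mul_X_mem_DplusXKX ι α⟩
      ⟨Polynomial.C α⁻¹ * Polynomial.X, C_mul_X_mem_DplusXKX ι α⁻¹⟩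
      ⟨⟨Polynomial.X, X_mem_DplusXKX ι⟩, Subtype.ext <| by
        change Polynomial.C α * Polynomial.X * (Polynomial.C α⁻¹ * Polynomial.X)
          = Polynomial.X * Polynomial.X
        rw [mul_mul_mul_comm, ← Polynomial.C_mul, mul_inv_cancel₀ hα0, Polynomial.C_1, one_mul]⟩
  replace hpq : Polynomial.X = p * q := congrArg Subtype.val hpq
  replace hpu : Polynomial.C α * Polynomial.X = p * u := congrArg Subtype.val hpu
  replace hqv : Polynomial.C α⁻¹ * Polynomial.X = q * v := congrArg Subtype.val hqv
  have hpq0 : 0 = p.coeff 0 * q.coeff 0 := by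
    simpa [Polynomial.mul_coeff_zero] using congrArg (Polynomial.coeff · 0) hpq
  have hpq1 : 1 = p.coeff 0 * q.coeff 1 + p.coeff 1 * q.coeff 0 := by
    simpa [Polynomial.mul_coeff_one] using congrArg (Polynomial.coeff · 1) hpq
  have hpu1 : α = p.coeff 0 * u.coeff 1 + p.coeff 1 * u.coeff 0 := by
    simpa [Polynomial.mul_coeff_one] using congrArg (Polynomial.coeff · 1) hpu
  have hqv1 : α⁻¹ = q.coeff 0 * v.coeff 1 + q.coeff 1 * v.coeff 0 := by
    simpa [Polynomial.mul_coeff_one] using congrArg (Polynomial.coeff · 1) hqv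
  rcases mul_eq_zero.mp hpq0.symm with h0 | h0
  · obtain ⟨d, hd⟩ := exists_coeff_zero_of_mem_DplusXKX hq
    obtain ⟨e, he⟩ := exists_coeff_zero_of_mem_DplusXKX hu
    rw [h0, zero_mul, zero_add, ← hd] at hpq1
    rw [h0, zero_mul, zero_add, ← he] at hpu1
    refine hα ⟨e, d, ?_, ?_⟩
    · rintro rfl
      simp at hpq1
    · linear_combination ι d * hpu1 - ι e * hpq1
  · obtain ⟨d, hd⟩ := exists_coeff_zero_of_mem_DplusXKX hp
    obtain ⟨e, he⟩ := exists_coeff_zero_of_mem_DplusXKX hv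
    rw [h0, mul_zero, add_zero, ← hd] at hpq1
    rw [h0, zero_mul, zero_add, ← he] at hqv1
    have key : ι e = ι d * α⁻¹ := by
      linear_combination ι e * hpq1 - ι d * hqv1
    refine hα ⟨d, e, ?_, ?_⟩
    · rintro rfl
      have hd0 : ι d ≠ 0 := by
        intro hd0
        simp [hd0] at hpq1
      simp [hd0, hα0] at key
    · rw [key]
      field_simp
end

section
/- The subring R = ℤ + xℝ[x] of ℝ[x], consisting of all real polynomials whose constant coefficient is an integer, is not a pre-Schreier domain. -/
/-- `R` is pre-Schreier if every nonzero nonunit of `R` is primal. -/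
def IsPreSchreier (R : Type*) [CommRing R] : Prop :=
  ∀ p : R, p ≠ 0 → ¬ IsUnit p → IsPrimalElem p

/-- The subring `ℤ + x ℝ[x]` of `ℝ[x]`: real polynomials whose constant coefficient
is an integer. -/
noncomputable def ZplusXRX : Subring (Polynomial ℝ) :=
  Subring.comap (Polynomial.constantCoeff (R := ℝ)) (Int.castRingHom ℝ).range

lemma mem_ZplusXRX_iff {f : Polynomial ℝ} : f ∈ ZplusXRX ↔ ∃ n : ℤ, (n : ℝ) = f.coeff 0 := by
  simp [ZplusXRX, Subring.mem_comap]

lemma C_mul_X_mem_ZplusXRX (a : ℝ) : Polynomial.C a * Polynomial.X ∈ ZplusXRX :=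
  mem_ZplusXRX_iff.2 ⟨0, by simp⟩

lemma sqrt_two_mul_intCast_ne {m n : ℤ} (hn : n ≠ 0) : (m : ℝ) ≠ √2 * n :=
  ((irrational_sqrt_two.mul_intCast hn).ne_int m).symm

/-- If `X = f * g` with `f` of zero constant coefficient and `g` of integer constant coefficient,
then no multiple of `f` by an element of `ℤ + x ℝ[x]` equals `√2 * X`. -/
lemma mul_ne_sqrt_two_mul_X {f g q : Polynomial ℝ} (hg : g ∈ ZplusXRX) (hq : q ∈ ZplusXRX)
    (hfg : f * g = Polynomial.X) (hf : f.coeff 0 = 0) :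
    f * q ≠ Polynomial.C √2 * Polynomial.X := by
  intro h
  obtain ⟨n, hn⟩ := mem_ZplusXRX_iff.1 hg
  obtain ⟨m, hm⟩ := mem_ZplusXRX_iff.1 hq
  have h₁ := congrArg (Polynomial.coeff · 1) hfg
  have h₂ := congrArg (Polynomial.coeff · 1) h
  simp only [Polynomial.mul_coeff_one, hf, zero_mul, zero_add, Polynomial.coeff_X_one, ← hn] at h₁
  simp only [Polynomial.mul_coeff_one f, hf, zero_mul, zero_add, Polynomial.coeff_C_mul,
    Polynomial.coeff_X_one, mul_one, ← hm] at h₂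
  have hn0 : n ≠ 0 := by
    rintro rfl
    simp at h₁
  refine sqrt_two_mul_intCast_ne (m := m) hn0 ?_
  linear_combination (n : ℝ) * h₂ - (m : ℝ) * h₁

theorem stmt9 : ¬ IsPreSchreier ↥ZplusXRX := by
  intro h
  let x : ZplusXRX := ⟨Polynomial.X, mem_ZplusXRX_iff.2 ⟨0, by simp⟩⟩
  let r : ZplusXRX := ⟨_, C_mul_X_mem_ZplusXRX √2⟩
  have hx0 : x ≠ 0 := fun e => Polynomial.X_ne_zero (congrArg Subtype.val e)
  have hxu : ¬ IsUnit x := fun e => Polynomial.not_isUnit_X (e.map ZplusXRX.subtype)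
  have hdvd : x ∣ r * r := by
    refine ⟨⟨_, C_mul_X_mem_ZplusXRX 2⟩, Subtype.ext ?_⟩
    have h2 : (Polynomial.C √2 * Polynomial.C √2 : Polynomial ℝ) = Polynomial.C 2 := by
      rw [← Polynomial.C_mul, Real.mul_self_sqrt zero_le_two]
    change Polynomial.C √2 * Polynomial.X * (Polynomial.C √2 * Polynomial.X)
      = Polynomial.X * (Polynomial.C 2 * Polynomial.X)
    linear_combination Polynomial.X ^ 2 * h2
  obtain ⟨f, g, hfg, ⟨q₁, hq₁⟩, ⟨q₂, hq₂⟩⟩ := h x hx0 hxu r r hdvd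
  have hfg' : (f : Polynomial ℝ) * (g : Polynomial ℝ) = Polynomial.X := (congrArg Subtype.val hfg).symm
  have hcoeff : (f : Polynomial ℝ).coeff 0 * (g : Polynomial ℝ).coeff 0 = 0 := by
    rw [← Polynomial.mul_coeff_zero, hfg', Polynomial.coeff_X_zero]
  rcases mul_eq_zero.1 hcoeff with hf | hg
  · exact mul_ne_sqrt_two_mul_X g.2 q₁.2 hfg' hf (congrArg Subtype.val hq₁).symm
  · exact mul_ne_sqrt_two_mul_X f.2 q₂.2 ((mul_comm _ _).trans hfg') hg
      (congrArg Subtype.val hq₂).symm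
end

section
/- Let R₀ = 𝔽₂[M] where M = ℚ≥0 × ℚ≥0 × ℚ≥0 × (ℕ → ℚ≥0), and let R be the 𝔽₂-subalgebra of R₀ generated by the monomials X^α, Y^α, Z^α for α ∈ ℚ≥0 together with all monomials X^α ∏_i T_i^{t(i)}, Y^α ∏_i T_i^{t(i)}, Z^α ∏_i T_i^{t(i)} with α ∈ ℚ, α > 0, and t : ℕ → ℚ≥0. Then R is a GL-domain. -/
/-- The additive monoid `ℚ≥0 × ℚ≥0 × ℚ≥0 × (ℕ → ℚ≥0)` of exponents of the monomials
`X^a Y^b Z^c ∏_i T_i^(t i)`. -/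
abbrev ExpMonoid : Type := ℚ≥0 × ℚ≥0 × ℚ≥0 × (ℕ → ℚ≥0)

/-- The monoid algebra `R₀ = 𝔽₂[ExpMonoid]`. -/
abbrev RZero : Type := AddMonoidAlgebra (ZMod 2) ExpMonoid

/-- The generating monomials of `R`: the monomials `X^α`, `Y^α`, `Z^α` for `α ∈ ℚ≥0`,
together with the monomials `X^α ∏_i T_i^(t i)`, `Y^α ∏_i T_i^(t i)`, `Z^α ∏_i T_i^(t i)`
for a positive rational `α` and `t : ℕ → ℚ≥0`. -/
def GenSet : Set RZero :=
  { x | (∃ α : ℚ≥0, x = AddMonoidAlgebra.single (α, 0, 0, 0) 1)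
      ∨ (∃ α : ℚ≥0, x = AddMonoidAlgebra.single (0, α, 0, 0) 1)
      ∨ (∃ α : ℚ≥0, x = AddMonoidAlgebra.single (0, 0, α, 0) 1)
      ∨ (∃ (α : ℚ≥0) (t : ℕ → ℚ≥0), 0 < α ∧ x = AddMonoidAlgebra.single (α, 0, 0, t) 1)
      ∨ (∃ (α : ℚ≥0) (t : ℕ → ℚ≥0), 0 < α ∧ x = AddMonoidAlgebra.single (0, α, 0, t) 1)
      ∨ (∃ (α : ℚ≥0) (t : ℕ → ℚ≥0), 0 < α ∧ x = AddMonoidAlgebra.single (0, 0, α, t) 1) }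

/-- The subalgebra `R` of `R₀` generated by `GenSet`. -/
noncomputable def RSub : Subalgebra (ZMod 2) RZero := Algebra.adjoin (ZMod 2) GenSet

open Finsupp in
/-- Riesz refinement: a relation between the elements `s j` of `ExpMonoid` becomes formal after
decomposing the `s j` suitably. -/
lemma exists_refinement_of_disjoint {ι : Type} (s : ι → ExpMonoid) (u v : ι →₀ ℕ)
    (huv : ∀ j, u j = 0 ∨ v j = 0)
    (h : linearCombination ℕ s u = linearCombination ℕ s v) :
    ∃ (κ : Type) (r : κ → ExpMonoid) (e : ι → κ →₀ ℕ),
      (∀ j, linearCombination ℕ r (e j) = s j) ∧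
        linearCombination ℕ e u = linearCombination ℕ e v := by
  classical
  set w := linearCombination ℕ s u with hw
  have le_w : ∀ (x : ι →₀ ℕ) j, x j ≠ 0 → s j ≤ linearCombination ℕ s x := by
    intro x j hj
    rw [linearCombination_apply, Finsupp.sum]
    calc s j ≤ x j • s j := le_self_nsmul zero_le hj
      _ ≤ _ := Finset.single_le_sum (f := fun i => x i • s i) (fun _ _ => zero_le)
        (Finsupp.mem_support_iff.2 hj)
  have cancel : ∀ a : ExpMonoid, a ≤ w → a * w * w⁻¹ = a := by
    have key : ∀ x y : ℚ≥0, x ≤ y → x * y * y⁻¹ = x := by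
      intro x y hxy
      rcases eq_or_ne y 0 with rfl | hy
      · simpa using (le_zero_iff.1 hxy).symm
      · exact mul_inv_cancel_right₀ hy x
    intro a ha
    obtain ⟨h1, h2, h3, h4⟩ := ha
    refine Prod.ext (key _ _ h1) (Prod.ext (key _ _ h2) (Prod.ext (key _ _ h3) ?_))
    funext i
    exact key _ _ (h4 i)
  have push : ∀ (a : ExpMonoid) (x : ι →₀ ℕ),
      linearCombination ℕ (fun l => a * s l * w⁻¹) x = a * linearCombination ℕ s x * w⁻¹ := by
    intro a x
    simp [linearCombination_apply, Finsupp.sum, Finset.mul_sum, Finset.sum_mul, mul_assoc, mul_left_comm]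
  refine ⟨Option ι × ι, fun p => p.1.elim (s p.2) (fun i => s i * s p.2 * w⁻¹),
    fun j => if u j ≠ 0 then v.mapDomain (fun l => (some j, l))
      else if v j ≠ 0 then u.mapDomain (fun i => (some i, j)) else single (none, j) 1, ?_, ?_⟩
  · intro j
    dsimp only
    split_ifs with h1 h2
    · rw [linearCombination_mapDomain]
      exact (push (s j) v).trans (by rw [← h]; exact cancel _ (le_w u j h1))
    · rw [linearCombination_mapDomain]
      have : ((fun p : Option ι × ι => p.1.elim (s p.2) (fun i => s i * s p.2 * w⁻¹)) ∘
          fun i => (some i, j)) = fun i => s j * s i * w⁻¹ := by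
        funext i
        simp [mul_comm (s i)]
      rw [this, push, ← hw]
      exact cancel _ (h ▸ le_w v j h2)
    · simp
  · simp only [linearCombination_apply, Finsupp.sum]
    have hu : ∀ j ∈ u.support, u j • (if u j ≠ 0 then v.mapDomain (fun l => (some j, l))
        else if v j ≠ 0 then u.mapDomain (fun i => (some i, j)) else single (none, j) 1) =
        ∑ l ∈ v.support, single (some j, l) (u j * v l) := by
      intro j hj
      rw [if_pos (Finsupp.mem_support_iff.1 hj), mapDomain, Finsupp.sum, Finset.smul_sum]
      simp
    have hv : ∀ l ∈ v.support, v l • (if u l ≠ 0 then v.mapDomain (fun i => (some l, i))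
        else if v l ≠ 0 then u.mapDomain (fun i => (some i, l)) else single (none, l) 1) =
        ∑ j ∈ u.support, single (some j, l) (u j * v l) := by
      intro l hl
      have hl' := Finsupp.mem_support_iff.1 hl
      rw [if_neg (not_not.2 ((huv l).resolve_right hl')), if_pos hl', mapDomain, Finsupp.sum,
        Finset.smul_sum]
      simp [mul_comm]
    rw [Finset.sum_congr rfl hu, Finset.sum_congr rfl hv, Finset.sum_comm]

open Finsupp in
lemma exists_refinement {ι : Type} (s : ι → ExpMonoid) (u v : ι →₀ ℕ)
    (h : linearCombination ℕ s u = linearCombination ℕ s v) :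
    ∃ (κ : Type) (r : κ → ExpMonoid) (e : ι → κ →₀ ℕ),
      (∀ j, linearCombination ℕ r (e j) = s j) ∧
        linearCombination ℕ e u = linearCombination ℕ e v := by
  classical
  have hu : u ⊓ v + (u - v) = u := by
    ext j; simp only [Finsupp.add_apply, Finsupp.inf_apply, Finsupp.tsub_apply]; omega
  have hv : u ⊓ v + (v - u) = v := by
    ext j; simp only [Finsupp.add_apply, Finsupp.inf_apply, Finsupp.tsub_apply]; omega
  obtain ⟨κ, r, e, h1, h2⟩ := exists_refinement_of_disjoint s (u - v) (v - u)
    (fun j => by simp only [Finsupp.tsub_apply]; omega) (by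
      have h' := congrArg₂ (· = ·) (congrArg (linearCombination ℕ s) hu)
        (congrArg (linearCombination ℕ s) hv)
      rw [map_add, map_add] at h'
      exact add_left_cancel (h'.mpr h))
  refine ⟨κ, r, e, h1, ?_⟩
  rw [← congrArg (linearCombination ℕ e) hu, ← congrArg (linearCombination ℕ e) hv, map_add,
    map_add, h2]

/-- The substitution homomorphism sending the variable `j` to the monomial with exponent `s j`. -/
noncomputable def monomialSubst {ι N : Type} [AddCommMonoid N] (s : ι → N) :
    MvPolynomial ι (ZMod 2) →ₐ[ZMod 2] AddMonoidAlgebra (ZMod 2) N :=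
  AddMonoidAlgebra.mapDomainAlgHom (ZMod 2) (ZMod 2)
    (Finsupp.linearCombination ℕ s).toAddMonoidHom

lemma coeff_monomialSubst {ι N : Type} [AddCommMonoid N] (s : ι → N)
    (p : MvPolynomial ι (ZMod 2)) :
    AddMonoidAlgebra.coeff (monomialSubst s p) =
      Finsupp.mapDomain (Finsupp.linearCombination ℕ s) (AddMonoidAlgebra.coeff p) := by
  simp [monomialSubst]

lemma monomialSubst_monomialSubst {ι κ N : Type} [AddCommMonoid N] (e : ι → κ →₀ ℕ) (r : κ → N)
    (p : MvPolynomial ι (ZMod 2)) :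
    monomialSubst r (monomialSubst e p : MvPolynomial κ (ZMod 2)) =
      monomialSubst (fun j => Finsupp.linearCombination ℕ r (e j)) p := by
  apply AddMonoidAlgebra.coeff_injective
  rw [coeff_monomialSubst, coeff_monomialSubst, coeff_monomialSubst, ← Finsupp.mapDomain_comp]
  congr 1
  funext u
  exact Finsupp.linearCombination_linearCombination ..

lemma monomialSubst_id_surjective : Function.Surjective (monomialSubst (id : ExpMonoid → _)) := by
  intro x
  refine ⟨.ofCoeff (Finsupp.mapDomain (fun m => Finsupp.single m 1) x.coeff), ?_⟩
  apply AddMonoidAlgebra.coeff_injective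
  rw [coeff_monomialSubst, AddMonoidAlgebra.coeff_ofCoeff, ← Finsupp.mapDomain_comp]
  have : Finsupp.linearCombination ℕ id ∘ (fun m : ExpMonoid => Finsupp.single m 1) = id := by
    funext m
    simp
  rw [this, Finsupp.mapDomain_id]

lemma exists_refinement_map_eq_zero : ∀ (n : ℕ) {ι : Type} (s : ι → ExpMonoid)
    (p : MvPolynomial ι (ZMod 2)), (AddMonoidAlgebra.coeff p).support.card ≤ n →
    monomialSubst s p = 0 →
    ∃ (κ : Type) (r : κ → ExpMonoid) (e : ι → κ →₀ ℕ),
      (∀ j, Finsupp.linearCombination ℕ r (e j) = s j) ∧ monomialSubst e p = 0 := by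
  classical
  intro n
  induction n with
  | zero =>
    intro ι s p hp _
    have : p = 0 := AddMonoidAlgebra.coeff_injective (by simpa using hp)
    exact ⟨ι, s, fun j => Finsupp.single j 1, by simp, by rw [this, map_zero]⟩
  | succ n ih =>
    intro ι s p hp h
    by_cases hinj : Set.InjOn (Finsupp.linearCombination ℕ s)
        ((AddMonoidAlgebra.coeff p).support : Set (ι →₀ ℕ))
    · have hs := Finsupp.mapDomain_support_of_injOn _ hinj
      rw [← coeff_monomialSubst, h] at hs
      refine ih s p ?_ h
      have : (AddMonoidAlgebra.coeff p).support = ∅ := by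
        rw [← Finset.image_eq_empty (f := Finsupp.linearCombination ℕ s), ← hs]; simp
      simp [this]
    · simp only [Set.InjOn, not_forall] at hinj
      obtain ⟨u, hu, v, hv, huv, hne⟩ := hinj
      obtain ⟨κ, r, e, h1, h2⟩ := exists_refinement s u v huv
      have hcard : (AddMonoidAlgebra.coeff (monomialSubst e p)).support.card ≤ n := by
        rw [coeff_monomialSubst]
        have hlt : ((AddMonoidAlgebra.coeff p).support.image
            (Finsupp.linearCombination ℕ e)).card < (AddMonoidAlgebra.coeff p).support.card := by
          refine lt_of_le_of_ne Finset.card_image_le fun heq => hne ?_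
          exact Finset.card_image_iff.1 heq hu hv h2
        have := Finset.card_le_card (Finsupp.mapDomain_support
          (f := Finsupp.linearCombination ℕ e) (s := AddMonoidAlgebra.coeff p))
        omega
      obtain ⟨κ', r', e', h3, h4⟩ := ih r (monomialSubst e p) hcard (by
        rw [monomialSubst_monomialSubst]; simpa only [h1] using h)
      refine ⟨κ', r', fun j => Finsupp.linearCombination ℕ e' (e j), fun j => ?_, ?_⟩
      · rw [Finsupp.linearCombination_linearCombination]; simp only [h3, h1]
      · rwa [monomialSubst_monomialSubst] at h4

lemma exists_refinement_forall_map_eq_zero {ι : Type} (s : ι → ExpMonoid)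
    (P : ℕ → MvPolynomial ι (ZMod 2)) (hP : ∀ k, monomialSubst s (P k) = 0) (n : ℕ) :
    ∃ (κ : Type) (r : κ → ExpMonoid) (e : ι → κ →₀ ℕ),
      (∀ j, Finsupp.linearCombination ℕ r (e j) = s j) ∧
        ∀ k < n, monomialSubst e (P k) = 0 := by
  induction n with
  | zero => exact ⟨ι, s, fun j => Finsupp.single j 1, by simp, by simp⟩
  | succ n ih =>
    obtain ⟨κ, r, e, h1, h2⟩ := ih
    obtain ⟨κ', r', e', h3, h4⟩ := exists_refinement_map_eq_zero _ r (monomialSubst e (P n)) le_rfl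
      (by rw [monomialSubst_monomialSubst]; simpa only [h1] using hP n)
    refine ⟨κ', r', fun j => Finsupp.linearCombination ℕ e' (e j), fun j => ?_, fun k hk => ?_⟩
    · rw [Finsupp.linearCombination_linearCombination]; simp only [h3, h1]
    · rw [← monomialSubst_monomialSubst]
      rcases Nat.lt_succ_iff_lt_or_eq.1 hk with hk | rfl
      · rw [h2 k hk]; exact map_zero _
      · exact h4

lemma exists_dvd_dvd_of_C_dvd_mul {A : Type*} [CommRing A] [IsDomain A]
    [UniqueFactorizationMonoid A] {d : A} {f g : Polynomial A} (h : Polynomial.C d ∣ f * g) :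
    ∃ a b, d = a * b ∧ Polynomial.C a ∣ f ∧ Polynomial.C b ∣ g := by
  let := UniqueFactorizationMonoid.strongNormalizationMonoid (α := A)
  let := UniqueFactorizationMonoid.toNormalizedGCDMonoid A
  rw [← Polynomial.dvd_content_iff_C_dvd,
    (Polynomial.associated_content_mul f g).dvd_iff_dvd_right] at h
  obtain ⟨a, b, ha, hb, rfl⟩ := exists_dvd_and_dvd_of_dvd_mul h
  exact ⟨a, b, rfl, Polynomial.dvd_content_iff_C_dvd.1 ha, Polynomial.dvd_content_iff_C_dvd.1 hb⟩

/-- Gauss's lemma for `RZero`: a constant dividing `f * g` splits into a divisor of `f` and a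
divisor of `g`. -/
lemma RZero.exists_dvd_dvd_of_C_dvd_mul {d : RZero} {f g : Polynomial RZero}
    (h : Polynomial.C d ∣ f * g) :
    ∃ a b, d = a * b ∧ Polynomial.C a ∣ f ∧ Polynomial.C b ∣ g := by
  obtain ⟨q, hq⟩ := h
  have hsurj := monomialSubst_id_surjective
  let φ := (monomialSubst (id : ExpMonoid → _)).toRingHom
  obtain ⟨d', rfl⟩ := hsurj d
  obtain ⟨f', rfl⟩ := Polynomial.map_surjective φ hsurj f
  obtain ⟨g', rfl⟩ := Polynomial.map_surjective φ hsurj g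
  obtain ⟨q', rfl⟩ := Polynomial.map_surjective φ hsurj q
  let P := f' * g' - Polynomial.C d' * q'
  have hP : P.map φ = 0 := by
    simp only [P, Polynomial.map_sub, Polynomial.map_mul, Polynomial.map_C]
    exact sub_eq_zero.2 hq
  obtain ⟨κ, r, e, h1, h2⟩ := exists_refinement_forall_map_eq_zero id P.coeff
    (fun k => (Polynomial.coeff_map φ k).symm.trans (congrArg (Polynomial.coeff · k) hP))
    (P.natDegree + 1)
  let θ : MvPolynomial ExpMonoid (ZMod 2) →+* MvPolynomial κ (ZMod 2) := (monomialSubst e).toRingHom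
  let ψ := (monomialSubst r).toRingHom
  have hcomp : ∀ x, ψ (θ x) = φ x := fun x => by
    have := monomialSubst_monomialSubst e r x
    simp only [h1] at this
    exact this
  have hcomp' : ψ.comp θ = φ := RingHom.ext hcomp
  have hθ : P.map θ = 0 := by
    ext1 k
    rw [Polynomial.coeff_map, Polynomial.coeff_zero]
    rcases lt_or_ge k (P.natDegree + 1) with hk | hk
    · exact h2 k hk
    · rw [Polynomial.coeff_eq_zero_of_natDegree_lt (by omega), map_zero]
  simp only [P, Polynomial.map_sub, Polynomial.map_mul, Polynomial.map_C, sub_eq_zero] at hθ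
  obtain ⟨a, b, hab, ha, hb⟩ := _root_.exists_dvd_dvd_of_C_dvd_mul (Dvd.intro _ hθ.symm)
  refine ⟨ψ a, ψ b, ?_, ?_, ?_⟩
  · rw [← map_mul, ← hab]
    exact (hcomp d').symm
  · have := map_dvd (Polynomial.mapRingHom ψ) ha
    rwa [Polynomial.coe_mapRingHom, Polynomial.map_C, Polynomial.map_map, hcomp'] at this
  · have := map_dvd (Polynomial.mapRingHom ψ) hb
    rwa [Polynomial.coe_mapRingHom, Polynomial.map_C, Polynomial.map_map, hcomp'] at this

lemma AddMonoidAlgebra.exists_eq_algebraMap_of_mul_eq_one {F N : Type*} [Field F] [AddCommMonoid N]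
    [TwoUniqueSums N] [Subsingleton (AddUnits N)] {x y : AddMonoidAlgebra F N} (h : x * y = 1) :
    ∃ c, x = algebraMap F _ c := by
  classical
  have hx : x ≠ 0 := by rintro rfl; simp at h
  have hy : y ≠ 0 := by rintro rfl; simp at h
  have key : ∀ a ∈ x.coeff.support, ∀ b ∈ y.coeff.support,
      UniqueAdd x.coeff.support y.coeff.support a b → a = 0 ∧ b = 0 := by
    intro a ha b hb hu
    have := AddMonoidAlgebra.coeff_mul_add_of_uniqueAdd hu
    rw [h, AddMonoidAlgebra.one_def, AddMonoidAlgebra.coeff_single] at this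
    have hne : x.coeff a * y.coeff b ≠ 0 :=
      mul_ne_zero (Finsupp.mem_support_iff.1 ha) (Finsupp.mem_support_iff.1 hb)
    rw [← this, Finsupp.single_apply_ne_zero] at hne
    exact add_eq_zero.1 hne.1
  obtain ⟨a, ha⟩ := Finsupp.support_nonempty_iff.2 (AddMonoidAlgebra.coeff_eq_zero.not.2 hx)
  obtain ⟨b, hb⟩ := Finsupp.support_nonempty_iff.2 (AddMonoidAlgebra.coeff_eq_zero.not.2 hy)
  have hcard : x.coeff.support.card * y.coeff.support.card ≤ 1 := by
    by_contra! hlt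
    obtain ⟨p, hp, q, hq, hpq, h1, h2⟩ := TwoUniqueSums.uniqueAdd_of_one_lt_card hlt
    rw [Finset.mem_product] at hp hq
    have hp' := key _ hp.1 _ hp.2 h1
    have hq' := key _ hq.1 _ hq.2 h2
    exact hpq (Prod.ext (hp'.1.trans hq'.1.symm) (hp'.2.trans hq'.2.symm))
  have hxpos := Finset.card_pos.2 ⟨a, ha⟩
  have hypos := Finset.card_pos.2 ⟨b, hb⟩
  have hx1 : x.coeff.support.card ≤ 1 := by nlinarith
  have hy1 : y.coeff.support.card ≤ 1 := by nlinarith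
  rw [Finset.card_le_one] at hx1 hy1
  obtain ⟨rfl, -⟩ := key a ha b hb fun a' b' ha' hb' _ => ⟨hx1 _ ha' _ ha, hy1 _ hb' _ hb⟩
  refine ⟨x.coeff 0, AddMonoidAlgebra.coeff_injective ?_⟩
  ext m
  rcases eq_or_ne m 0 with rfl | hm
  · simp
  · have : x.coeff m = 0 := by
      by_contra hne
      exact hm (hx1 _ (Finsupp.mem_support_iff.2 hne) _ ha)
    simp [this, hm]

lemma RZero.exists_sq_eq (x : RZero) : ∃ y, y ^ 2 = x := by
  have : CharP RZero 2 := charP_of_injective_algebraMap (algebraMap (ZMod 2) RZero).injective 2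
  induction x using AddMonoidAlgebra.induction_linear with
  | zero => exact ⟨0, by simp⟩
  | add x y hx hy =>
    obtain ⟨a, rfl⟩ := hx
    obtain ⟨b, rfl⟩ := hy
    exact ⟨a + b, CharTwo.add_sq a b⟩
  | single m r =>
    have half : ∀ q : ℚ≥0, q / 2 + q / 2 = q := add_halves
    refine ⟨.single (m.1 / 2, m.2.1 / 2, m.2.2.1 / 2, fun i => m.2.2.2 i / 2) r, ?_⟩
    rw [sq, AddMonoidAlgebra.single_mul_single]
    congr 1
    · refine Prod.ext (half _) (Prod.ext (half _) (Prod.ext (half _) (funext fun i => half _)))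
    · rw [← sq]
      exact ZMod.pow_card r

/-- The monomial `∏ i, T i ^ t i` if the exponents of `X`, `Y`, `Z` vanish, and zero otherwise. -/
noncomputable def tPartMonoidHom :
    Multiplicative ExpMonoid →* AddMonoidAlgebra (ZMod 2) (ℕ → ℚ≥0) where
  toFun m := if m.toAdd.1 = 0 ∧ m.toAdd.2.1 = 0 ∧ m.toAdd.2.2.1 = 0
    then .single m.toAdd.2.2.2 1 else 0
  map_one' := by simp [AddMonoidAlgebra.one_def]
  map_mul' a b := by
    simp only [toAdd_mul, Prod.fst_add, Prod.snd_add, add_eq_zero]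
    split_ifs <;> simp_all [AddMonoidAlgebra.single_mul_single]

/-- Setting `X = Y = Z = 0`. -/
noncomputable def tPart : RZero →ₐ[ZMod 2] AddMonoidAlgebra (ZMod 2) (ℕ → ℚ≥0) :=
  AddMonoidAlgebra.lift (ZMod 2) _ _ tPartMonoidHom

lemma tPart_single (m : ExpMonoid) (c : ZMod 2) :
    tPart (.single m c) = if m.1 = 0 ∧ m.2.1 = 0 ∧ m.2.2.1 = 0 then .single m.2.2.2 c else 0 := by
  rw [tPart, AddMonoidAlgebra.lift_single, tPartMonoidHom]
  simp

/-- The inclusion of the algebra of monomials in the `T i`. -/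
noncomputable def tIncl : AddMonoidAlgebra (ZMod 2) (ℕ → ℚ≥0) →ₐ[ZMod 2] RZero :=
  AddMonoidAlgebra.mapDomainAlgHom (ZMod 2) (ZMod 2)
    ⟨⟨fun t => (0, 0, 0, t), rfl⟩, fun a b => by simp⟩

lemma single_mem_RSub (m : ExpMonoid) (c : ZMod 2)
    (h : ¬ (m.1 = 0 ∧ m.2.1 = 0 ∧ m.2.2.1 = 0)) : AddMonoidAlgebra.single m c ∈ RSub := by
  obtain ⟨a, b, d, t⟩ := m
  have hX : ∀ α, AddMonoidAlgebra.single (α, 0, 0, 0) 1 ∈ RSub := fun α =>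
    Algebra.subset_adjoin (.inl ⟨α, rfl⟩)
  have hY : ∀ α, AddMonoidAlgebra.single (0, α, 0, 0) 1 ∈ RSub := fun α =>
    Algebra.subset_adjoin (.inr (.inl ⟨α, rfl⟩))
  have hZ : ∀ α, AddMonoidAlgebra.single (0, 0, α, 0) 1 ∈ RSub := fun α =>
    Algebra.subset_adjoin (.inr (.inr (.inl ⟨α, rfl⟩)))
  suffices h1 : AddMonoidAlgebra.single (a, b, d, t) 1 ∈ RSub by
    have := RSub.smul_mem h1 c
    rwa [AddMonoidAlgebra.smul_single, smul_eq_mul, mul_one] at this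
  by_cases ha : a = 0
  · by_cases hb : b = 0
    · have hd : 0 < d := pos_iff_ne_zero.2 fun hd => h ⟨ha, hb, hd⟩
      have hT : AddMonoidAlgebra.single (0, 0, d, t) 1 ∈ RSub :=
        Algebra.subset_adjoin (.inr (.inr (.inr (.inr (.inr ⟨d, t, hd, rfl⟩)))))
      rwa [ha, hb]
    · have hT : AddMonoidAlgebra.single (0, b, 0, t) 1 ∈ RSub :=
        Algebra.subset_adjoin
          (.inr (.inr (.inr (.inr (.inl ⟨b, t, pos_iff_ne_zero.2 hb, rfl⟩)))))
      have := RSub.mul_mem hT (hZ d)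
      simpa [AddMonoidAlgebra.single_mul_single, ha] using this
  · have hT : AddMonoidAlgebra.single (a, 0, 0, t) 1 ∈ RSub :=
      Algebra.subset_adjoin (.inr (.inr (.inr (.inl ⟨a, t, pos_iff_ne_zero.2 ha, rfl⟩))))
    have := RSub.mul_mem (RSub.mul_mem hT (hY b)) (hZ d)
    simpa [AddMonoidAlgebra.single_mul_single] using this

lemma sub_tIncl_tPart_mem_RSub (x : RZero) : x - tIncl (tPart x) ∈ RSub := by
  induction x using AddMonoidAlgebra.induction_linear with
  | zero => simp
  | add x y hx hy =>
    rw [map_add, map_add, add_sub_add_comm]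
    exact RSub.add_mem hx hy
  | single m c =>
    rw [tPart_single]
    split_ifs with h
    · have : tIncl (.single m.2.2.2 c) = AddMonoidAlgebra.single m c := by
        obtain ⟨a, b, d, t⟩ := m
        obtain ⟨rfl, rfl, rfl⟩ := h
        simp [tIncl]
      rw [this, sub_self]
      exact RSub.zero_mem
    · rw [map_zero, sub_zero]
      exact single_mem_RSub m c h

lemma mem_RSub_iff (x : RZero) : x ∈ RSub ↔ ∃ c, tPart x = algebraMap (ZMod 2) _ c := by
  constructor
  · intro hx
    have hle : RSub ≤ (⊥ : Subalgebra (ZMod 2) _).comap tPart := by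
      refine Algebra.adjoin_le ?_
      have hmem : ∀ m : ExpMonoid, (m.1 = 0 ∧ m.2.1 = 0 ∧ m.2.2.1 = 0 → m.2.2.2 = 0) →
          AddMonoidAlgebra.single m 1 ∈ (⊥ : Subalgebra (ZMod 2) _).comap tPart := by
        intro m hm
        rw [Subalgebra.mem_comap, tPart_single]
        split_ifs with h
        · rw [hm h, ← AddMonoidAlgebra.one_def]
          exact one_mem _
        · exact zero_mem _
      rintro _ (⟨α, rfl⟩ | ⟨α, rfl⟩ | ⟨α, rfl⟩ | ⟨α, t, hα, rfl⟩ | ⟨α, t, hα, rfl⟩ |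
        ⟨α, t, hα, rfl⟩)
      all_goals
        refine hmem _ ?_
        simp
      all_goals exact fun h => absurd h hα.ne'
    obtain ⟨c, hc⟩ := Algebra.mem_bot.1 (hle hx)
    exact ⟨c, hc.symm⟩
  · rintro ⟨c, hc⟩
    have := sub_tIncl_tPart_mem_RSub x
    rw [hc, AlgHom.commutes] at this
    simpa using RSub.add_mem this (RSub.algebraMap_mem c)

/-- An element of `RSub` all of whose monomials involve `X`, `Y` or `Z` is not a unit. -/
lemma not_isUnit_of_tPart_eq_zero {d : RSub} (h : tPart d = 0) : ¬ IsUnit d := by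
  intro hd
  have := (hd.map RSub.val).map tPart
  exact not_isUnit_zero (h ▸ this)

/-- A divisor in `RZero`, with vanishing `tPart`, of the coefficients of a polynomial over `RSub`
prevents the polynomial from being primitive. -/
lemma IsPrimitivePoly.tPart_ne_zero {f : Polynomial RSub} (hf : IsPrimitivePoly f) {a : RZero}
    (h : ∀ n, a ∣ (f.coeff n : RZero)) : tPart a ≠ 0 := by
  intro ha
  obtain ⟨e, rfl⟩ := RZero.exists_sq_eq a
  rw [map_pow] at ha
  have he := eq_zero_of_pow_eq_zero ha
  have hmul : ∀ x, e * x ∈ RSub := fun x =>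
    (mem_RSub_iff _).2 ⟨0, by rw [map_mul, he, zero_mul, map_zero]⟩
  have he' : e ∈ RSub := by simpa using hmul 1
  refine not_isUnit_of_tPart_eq_zero (d := ⟨e, he'⟩) he (hf _ fun n => ?_)
  obtain ⟨x, hx⟩ := h n
  exact ⟨⟨e * x, hmul x⟩, Subtype.ext (by rw [hx, sq, mul_assoc]; rfl)⟩

/-- A divisor in `RZero`, with `tPart` a nonzero constant, of the coefficients of a primitive
polynomial over `RSub` is a unit of `RSub`. -/
lemma IsPrimitivePoly.isUnit_of_tPart_eq {f : Polynomial RSub} (hf : IsPrimitivePoly f) {a : RSub}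
    (h : ∀ n, (a : RZero) ∣ f.coeff n) (ha : tPart a ≠ 0) : IsUnit a := by
  refine hf a fun n => ?_
  obtain ⟨x, hx⟩ := h n
  obtain ⟨c, hc⟩ := (mem_RSub_iff _).1 a.2
  obtain ⟨b, hb⟩ := (mem_RSub_iff _).1 (f.coeff n).2
  have hc0 : c ≠ 0 := by rintro rfl; exact ha (by rw [hc, map_zero])
  refine ⟨⟨x, (mem_RSub_iff _).2 ⟨c⁻¹ * b, ?_⟩⟩, Subtype.ext hx⟩
  rw [map_mul, ← hb, hx, map_mul, hc, ← mul_assoc, ← map_mul, inv_mul_cancel₀ hc0, map_one, one_mul]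

theorem stmt12 : IsGLDomain ↥RSub := by
  intro f g hf hg d hd
  have hdvd : Polynomial.C (d : RZero) ∣
      f.map RSub.val.toRingHom * g.map RSub.val.toRingHom := by
    rw [← Polynomial.map_mul, Polynomial.C_dvd_iff_dvd_coeff]
    intro n
    rw [Polynomial.coeff_map]
    exact map_dvd RSub.val.toRingHom (hd n)
  obtain ⟨a, b, hab, ha, hb⟩ := RZero.exists_dvd_dvd_of_C_dvd_mul hdvd
  rw [Polynomial.C_dvd_iff_dvd_coeff] at ha hb
  replace ha : ∀ n, a ∣ (f.coeff n : RZero) := fun n => by simpa [Polynomial.coeff_map] using ha n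
  replace hb : ∀ n, b ∣ (g.coeff n : RZero) := fun n => by simpa [Polynomial.coeff_map] using hb n
  have ha0 := hf.tPart_ne_zero ha
  have hb0 := hg.tPart_ne_zero hb
  obtain ⟨c, hc⟩ := (mem_RSub_iff _).1 d.2
  rw [hab, map_mul] at hc
  have hc0 : c ≠ 0 := by
    rintro rfl
    rw [map_zero] at hc
    exact mul_ne_zero ha0 hb0 hc
  have hc1 : c = 1 := (Fin.exists_fin_two.1 ⟨c, rfl⟩).resolve_left hc0
  rw [hc1, map_one] at hc
  have haR := (mem_RSub_iff a).2 (AddMonoidAlgebra.exists_eq_algebraMap_of_mul_eq_one hc)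
  have hbR := (mem_RSub_iff b).2
    (AddMonoidAlgebra.exists_eq_algebraMap_of_mul_eq_one ((mul_comm _ _).trans hc))
  have hd' : d = ⟨a, haR⟩ * ⟨b, hbR⟩ := Subtype.ext hab
  rw [hd']
  exact (hf.isUnit_of_tPart_eq (a := ⟨a, haR⟩) ha ha0).mul
    (hg.isUnit_of_tPart_eq (a := ⟨b, hbR⟩) hb hb0)
end
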